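/- Let f : X → Y be a continuous map, where X and Y each have the homotopy type of an ANR space (i.e., each is homotopy equivalent to some ANR space). Then secat(f) = secat_g(f). -/

import Mathlib

open ContinuousMap Set

noncomputable section

universe u v

/-- A topological space `Z` is an ANR: it is metrizable and for every metrizable space `M`,
every closed subset `A ⊆ M` and every continuous map `A → Z`, the map extends continuously
over some open set `U` with `A ⊆ U ⊆ M`. -/
def IsANR (Z : Type u) [TopologicalSpace Z] : Prop :=
  TopologicalSpace.MetrizableSpace Z ∧
    ∀ (M : Type u) [TopologicalSpace M] [TopologicalSpace.MetrizableSpace M]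
      (A : Set M), IsClosed A → ∀ f : C(A, Z),
        ∃ (U : Set M) (hAU : A ⊆ U), IsOpen U ∧
          ∃ F : C(U, Z), ∀ (a : M) (ha : a ∈ A), F ⟨a, hAU ha⟩ = f ⟨a, ha⟩

/-- `X` has the homotopy type of an ANR space. -/
def HasANRHomotopyType (X : Type u) [TopologicalSpace X] : Prop :=
  ∃ (Z : Type u) (i : TopologicalSpace Z), @IsANR Z i ∧
    Nonempty (@ContinuousMap.HomotopyEquiv X Z _ i)

/-- The inclusion of a subset `U ⊆ B` as a continuous map. -/
def restr {B : Type*} [TopologicalSpace B] (U : Set B) : C(U, B) :=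
  ⟨Subtype.val, continuous_subtype_val⟩

/-- The sectional category of a continuous map `p : E → B`. -/
def secat {E B : Type*} [TopologicalSpace E] [TopologicalSpace B] (p : C(E, B)) : ℕ∞ :=
  sInf {n : ℕ∞ | ∃ k : ℕ, n = (k : ℕ∞) ∧ ∃ U : Fin (k + 1) → Set B,
    (∀ i, IsOpen (U i)) ∧ (⋃ i, U i) = Set.univ ∧
    ∀ i, ∃ s : C(U i, E), (p.comp s).Homotopic (restr (U i))}

/-- The generalized sectional category of `p : E → B` (covers by arbitrary subsets). -/
def gsecat {E B : Type*} [TopologicalSpace E] [TopologicalSpace B] (p : C(E, B)) : ℕ∞ :=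
  sInf {n : ℕ∞ | ∃ k : ℕ, n = (k : ℕ∞) ∧ ∃ U : Fin (k + 1) → Set B,
    (⋃ i, U i) = Set.univ ∧
    ∀ i, ∃ s : C(U i, E), (p.comp s).Homotopic (restr (U i))}

open Topology unitInterval

lemma ballfun {P : Type*} [PseudoMetricSpace P] (W : Set P) (hW : IsOpen W) :
    ∃ μ : P → ℝ, Continuous μ ∧ (∀ z ∈ W, 0 < μ z) ∧ (∀ z, 0 ≤ μ z) ∧
      ∀ z, Metric.ball z (μ z) ⊆ W := by
  rcases (Wᶜ).eq_empty_or_nonempty with h | h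
  · refine ⟨fun _ => 1, continuous_const, fun _ _ => one_pos, fun _ => zero_le_one, fun z y _ => ?_⟩
    by_contra hy
    have : y ∈ Wᶜ := hy
    rw [h] at this
    exact this
  · refine ⟨fun z => Metric.infDist z Wᶜ, Metric.continuous_infDist_pt _, fun z hz => ?_,
      fun z => Metric.infDist_nonneg, fun z => Metric.ball_infDist_compl_subset⟩
    exact (hW.isClosed_compl.notMem_iff_infDist_pos h).1 (fun h => h hz)

/-- Key extension trick. -/
lemma trick {N L : Type u} [MetricSpace N] [TopologicalSpace L] [Nonempty L] (hL : IsANR L)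
    (B D : Set N) (hD : IsClosed D) (φ ψ : N → L) (hφ : ContinuousOn φ B) (hψ : ContinuousOn ψ D)
    (hag : ∀ x ∈ B, x ∈ D → φ x = ψ x) :
    ∃ O : Set N, IsOpen O ∧ B ⊆ O ∧ ∃ G : N × ℝ → L,
      ContinuousOn G (O ×ˢ Ioc 0 1 ∪ B ×ˢ Icc 0 1) ∧ (∀ x ∈ B, G (x, 0) = φ x) ∧
      ∀ x ∈ O, x ∈ D → ∀ t ∈ Ioc (0 : ℝ) 1, G (x, t) = ψ x := by
  classical
  let T : Set (N × ℝ) := {z | 0 < z.2 ∨ (z.2 = 0 ∧ z.1 ∈ B)}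
  let A : Set T := {z | z.1.2 = 0 ∨ z.1.1 ∈ D}
  let k : A → L := fun z => if z.1.1.2 = 0 then φ z.1.1.1 else ψ z.1.1.1
  have hcl0 : IsClosed {z : T | z.1.2 = 0} := isClosed_eq (by fun_prop) continuous_const
  have hcl1 : IsClosed {z : T | z.1.1 ∈ D} := hD.preimage (by fun_prop)
  have hA : IsClosed A := hcl0.union hcl1
  have hk : Continuous k := by
    rw [← continuousOn_univ]
    have : (univ : Set A) = {z : A | z.1.1.2 = 0} ∪ {z : A | z.1.1.1 ∈ D} := by
      ext z
      exact ⟨fun _ => z.2, fun _ => mem_univ _⟩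
    rw [this]
    refine ContinuousOn.union_of_isClosed ?_ ?_ (isClosed_eq (by fun_prop) continuous_const)
      (hD.preimage (by fun_prop))
    · have h1 : ContinuousOn (fun z : A => φ z.1.1.1) {z : A | z.1.1.2 = 0} := by
        refine hφ.comp (by fun_prop) ?_
        intro z hz
        have hz : z.1.1.2 = 0 := hz
        rcases z.1.2 with h | h
        · exact absurd hz h.ne'
        · exact h.2
      refine h1.congr ?_
      intro z hz
      have hz : z.1.1.2 = 0 := hz
      simp [k, hz]
    · have h1 : ContinuousOn (fun z : A => ψ z.1.1.1) {z : A | z.1.1.1 ∈ D} :=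
        hψ.comp (by fun_prop) (fun z hz => hz)
      refine h1.congr ?_
      intro z hz
      by_cases h0 : z.1.1.2 = 0
      · have hB : z.1.1.1 ∈ B := by
          rcases z.1.2 with h | h
          · exact absurd h0 h.ne'
          · exact h.2
        simp [k, h0, hag _ hB hz]
      · simp [k, h0]
  obtain ⟨U, hAU, hU, F, hF⟩ := hL.2 T A hA ⟨k, hk⟩
  obtain ⟨V, hV, rfl⟩ := isOpen_induced_iff.1 hU
  obtain ⟨μ, hμc, hμp, hμ0, hμ⟩ := ballfun V hV
  let m : N → ℝ := fun x => μ (x, 0) / 2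
  have hm : Continuous m := by fun_prop
  have key : ∀ x t, 0 ≤ t → t ≤ 1 → 0 < m x → (x, t * m x) ∈ V := by
    intro x t h0 h1 hx
    apply hμ (x, 0)
    have : t * m x < μ (x, 0) := by
      have : m x = μ (x, 0) / 2 := rfl
      nlinarith
    have h2 : 0 ≤ t * m x := by positivity
    simp [Prod.dist_eq]
    constructor
    · have : m x = μ (x, 0) / 2 := rfl
      linarith
    · have h3 : |t| * |m x| = t * m x := by rw [abs_of_nonneg h0, abs_of_pos hx]
      linarith
  have hBm : ∀ x ∈ B, 0 < m x := by
    intro x hx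
    have h1 : (⟨(x, 0), Or.inr ⟨rfl, hx⟩⟩ : T) ∈ A := Or.inl rfl
    have h2 := hμp (x, 0) (hAU h1)
    exact half_pos h2
  let S : Set (N × ℝ) := {x | 0 < m x} ×ˢ Ioc 0 1 ∪ B ×ˢ Icc 0 1
  have hST : ∀ z ∈ S, (z.1, z.2 * m z.1) ∈ T ∧ (z.1, z.2 * m z.1) ∈ V := by
    rintro ⟨x, t⟩ (⟨hx, ht⟩ | ⟨hx, ht⟩)
    · exact ⟨Or.inl (mul_pos ht.1 hx), key x t ht.1.le ht.2 hx⟩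
    · refine ⟨?_, key x t ht.1 ht.2 (hBm x hx)⟩
      rcases ht.1.eq_or_lt with h | h
      · right
        have h : t = 0 := h.symm
        exact ⟨by simp [h], hx⟩
      · exact Or.inl (mul_pos h (hBm x hx))
  let G : N × ℝ → L := fun z => if h : z ∈ S then
    F ⟨⟨(z.1, z.2 * m z.1), (hST z h).1⟩, (hST z h).2⟩ else Classical.arbitrary L
  refine ⟨{x | 0 < m x}, isOpen_lt continuous_const hm, hBm, G, ?_, ?_, ?_⟩
  · rw [continuousOn_iff_continuous_domRestrict]
    have : S.domRestrict G = fun z : S => F ⟨⟨(z.1.1, z.1.2 * m z.1.1), (hST z z.2).1⟩,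
        (hST z z.2).2⟩ := by
      ext z
      exact dif_pos z.2
    change Continuous (S.domRestrict G)
    rw [this]
    refine F.continuous.comp ?_
    refine Continuous.subtype_mk (Continuous.subtype_mk ?_ _) _
    fun_prop
  · intro x hx
    have hS : (x, (0 : ℝ)) ∈ S := Or.inr ⟨hx, by simp⟩
    have h1 : (⟨(x, 0 * m x), (hST _ hS).1⟩ : T) ∈ A := Or.inl (by simp)
    simp only [G, dif_pos hS]
    rw [hF _ h1]
    simp [k]
  · intro x hx hxD t ht
    have hS : (x, t) ∈ S := Or.inl ⟨hx, ht⟩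
    have h1 : (⟨(x, t * m x), (hST _ hS).1⟩ : T) ∈ A := Or.inr hxD
    simp only [G, dif_pos hS]
    rw [hF _ h1]
    have : t * m x ≠ 0 := (mul_pos ht.1 hx).ne'
    simp only [k, ContinuousMap.coe_mk]
    rw [if_neg this]

/-- Homotopies between maps into ANRs extend to neighbourhoods. -/
lemma homotopy_nhd {M L : Type v} [MetricSpace M] [TopologicalSpace L] (hL : IsANR L)
    (p q : C(M, L)) (A : Set M) (h : (p.comp (restr A)).Homotopic (q.comp (restr A))) :
    ∃ V : Set M, IsOpen V ∧ A ⊆ V ∧ (p.comp (restr V)).Homotopic (q.comp (restr V)) := by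
  classical
  rcases A.eq_empty_or_nonempty with rfl | ⟨a0, ha0⟩
  · refine ⟨∅, isOpen_empty, subset_rfl, ?_⟩
    have : p.comp (restr (∅ : Set M)) = q.comp (restr (∅ : Set M)) := by
      ext x; exact x.2.elim
    rw [this]
  haveI : Nonempty L := ⟨p a0⟩
  obtain ⟨H⟩ := h
  let φ : M × I → L := fun z => if h : z.1 ∈ A then H (z.2, ⟨z.1, h⟩) else Classical.arbitrary L
  let ψ : M × I → L := fun z => if z.2 = 0 then p z.1 else q z.1
  let B : Set (M × I) := {z | z.1 ∈ A}
  let D : Set (M × I) := {z | z.2 = 0} ∪ {z | z.2 = 1}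
  have c0 : IsClosed {z : M × I | z.2 = 0} := isClosed_eq (by fun_prop) continuous_const
  have c1 : IsClosed {z : M × I | z.2 = 1} := isClosed_eq (by fun_prop) continuous_const
  have hφ : ContinuousOn φ B := by
    rw [continuousOn_iff_continuous_domRestrict]
    have : B.domRestrict φ = fun z : B => H (z.1.2, ⟨z.1.1, z.2⟩) := by
      ext z
      exact dif_pos (show z.1.1 ∈ A from z.2)
    rw [this]
    refine H.continuous.comp ?_
    refine Continuous.prodMk (by fun_prop) (Continuous.subtype_mk (by fun_prop) _)
  have hψ : ContinuousOn ψ D := by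
    refine ContinuousOn.union_of_isClosed ?_ ?_ c0 c1
    · have : ContinuousOn (fun z : M × I => p z.1) {z : M × I | z.2 = 0} := by fun_prop
      refine this.congr fun z hz => ?_
      have hz : z.2 = 0 := hz
      simp [ψ, hz]
    · have : ContinuousOn (fun z : M × I => q z.1) {z : M × I | z.2 = 1} := by fun_prop
      refine this.congr fun z hz => ?_
      have hz : z.2 = 1 := hz
      simp [ψ, hz]
  obtain ⟨O, hO, hBO, G, hG, -, hGD⟩ := trick hL B D (c0.union c1) φ ψ hφ hψ (by
    rintro ⟨x, s⟩ hx (hs | hs)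
    · have hx : x ∈ A := hx
      have hs : s = 0 := hs
      subst hs
      have h1 : φ (x, 0) = H (0, ⟨x, hx⟩) := dif_pos hx
      rw [h1, H.apply_zero]
      simp [ψ, restr]
    · have hx : x ∈ A := hx
      have hs : s = 1 := hs
      subst hs
      have h1 : φ (x, 1) = H (1, ⟨x, hx⟩) := dif_pos hx
      rw [h1, H.apply_one]
      simp [ψ, restr])
  let V : Set M := (Prod.fst '' Oᶜ)ᶜ
  have hVO : ∀ x ∈ V, ∀ s, (x, s) ∈ O := by
    intro x hx s
    by_contra hc
    exact hx ⟨(x, s), hc, rfl⟩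
  refine ⟨V, (isClosedMap_fst_of_compactSpace _ hO.isClosed_compl).isOpen_compl, ?_, ?_⟩
  · rintro x hx ⟨⟨y, s⟩, hy, rfl⟩
    exact hy (hBO hx)
  · refine ⟨⟨⟨fun z => G ((z.2.1, z.1), 1), ?_⟩, ?_, ?_⟩⟩
    · refine hG.comp_continuous (by fun_prop) ?_
      intro z
      exact Or.inl ⟨hVO _ z.2.2 _, by simp⟩
    · intro x
      have := hGD (x.1, 0) (hVO _ x.2 _) (Or.inl rfl) 1 (by simp)
      simp [this, ψ, restr]
    · intro x
      have := hGD (x.1, 1) (hVO _ x.2 _) (Or.inr rfl) 1 (by simp)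
      simp [this, ψ, restr]

/-- Kuratowski embedding -/
lemma exists_kuratowski (K : Type u) [MetricSpace K] [Nonempty K] :
    ∃ ι : K → BoundedContinuousFunction K ℝ, Isometry ι := by
  let x0 : K := Classical.arbitrary K
  let ι : K → BoundedContinuousFunction K ℝ := fun x =>
    BoundedContinuousFunction.ofNormedAddCommGroup (fun y => dist x y - dist x0 y) (by fun_prop)
      (dist x x0) (fun y => by rw [Real.norm_eq_abs]; exact abs_dist_sub_le _ _ _)
  refine ⟨ι, Isometry.of_dist_eq fun x y => le_antisymm ?_ ?_⟩
  · rw [BoundedContinuousFunction.dist_le dist_nonneg]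
    intro z
    have : dist (ι x z) (ι y z) = |dist x z - dist y z| := by
      simp [ι, Real.dist_eq]
    rw [this]
    exact abs_dist_sub_le _ _ _
  · have h := BoundedContinuousFunction.dist_coe_le_dist (f := ι x) (g := ι y) y
    have h2 : dist (ι x y) (ι y y) = dist x y := by
      simp [ι, Real.dist_eq]
    rwa [h2] at h

/-- Maps from arbitrary subsets into ANRs extend to a neighbourhood up to homotopy;
note the independent universes. -/
lemma ext_up_to_homotopy {M : Type v} [MetricSpace M] {K : Type u} [TopologicalSpace K]
    (hK : IsANR K) (A : Set M) (f : C(A, K)) :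
    ∃ (U : Set M) (hAU : A ⊆ U), IsOpen U ∧ ∃ g : C(U, K),
      (g.comp (ContinuousMap.inclusion hAU)).Homotopic f := by
  classical
  rcases A.eq_empty_or_nonempty with rfl | ⟨a0, ha0⟩
  · refine ⟨∅, subset_rfl, isOpen_empty, f, ?_⟩
    have : f.comp (ContinuousMap.inclusion subset_rfl) = f := by
      ext x; rfl
    rw [this]
  haveI : Nonempty K := ⟨f ⟨a0, ha0⟩⟩
  haveI := hK.1
  letI : MetricSpace K := TopologicalSpace.metrizableSpaceMetric K
  obtain ⟨ι, hι⟩ := exists_kuratowski K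
  let j := Function.invFun ι
  have hj : ∀ x, j (ι x) = x := Function.leftInverse_invFun hι.injective
  have hjc : ContinuousOn j (range ι) := by
    rw [continuousOn_iff_continuous_domRestrict]
    have h2 : Continuous (hι.isEmbedding.toHomeomorph.symm) :=
      hι.isEmbedding.toHomeomorph.symm.continuous
    refine h2.congr fun y => ?_
    obtain ⟨x, rfl⟩ := hι.isEmbedding.toHomeomorph.surjective y
    rw [Homeomorph.symm_apply_apply]
    exact (hj x).symm
  obtain ⟨W, hW, hBW, G, hG, hG0, -⟩ := trick hK (range ι) ∅ isClosed_empty j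
    (fun _ => f ⟨a0, ha0⟩) hjc (continuousOn_empty _) (by simp)
  obtain ⟨μ, hμc, hμp, hμ0, hμ⟩ := ballfun W hW
  let F : A → BoundedContinuousFunction K ℝ := fun a => ι (f a)
  have hF : Continuous F := hι.continuous.comp f.continuous
  have hFW : ∀ a, F a ∈ W := fun a => hBW ⟨_, rfl⟩
  have hN : ∀ a : A, ∃ N : Set M, IsOpen N ∧ a.1 ∈ N ∧
      ∀ y : A, y.1 ∈ N → F a ∈ Metric.ball (F y) (μ (F y)) := by
    intro a
    have ho : IsOpen {y : A | dist (F a) (F y) < μ (F y)} :=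
      isOpen_lt (by fun_prop) (by fun_prop)
    obtain ⟨N, hN, hN2⟩ := isOpen_induced_iff.1 ho
    refine ⟨N, hN, ?_, ?_⟩
    · have : a ∈ Subtype.val ⁻¹' N := by
        rw [hN2]
        simpa using hμp _ (hFW a)
      exact this
    · intro y hy
      have : y ∈ Subtype.val ⁻¹' N := hy
      rw [hN2] at this
      exact this
  choose N hNo hNa hN using hN
  let U0 : Set M := ⋃ a, N a
  have hU0 : IsOpen U0 := isOpen_iUnion hNo
  have hAU0 : ∀ a : A, a.1 ∈ U0 := fun a => mem_iUnion.2 ⟨a, hNa a⟩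
  let t : U0 → Set (BoundedContinuousFunction K ℝ) := fun x =>
    ⋂ h : x.1 ∈ A, Metric.ball (F ⟨x.1, h⟩) (μ (F ⟨x.1, h⟩))
  obtain ⟨g0, hg0⟩ := exists_continuous_forall_mem_convex_of_local_const (t := t)
    (fun x => convex_iInter fun h => convex_ball _ _) (by
      intro x
      obtain ⟨a, ha⟩ := mem_iUnion.1 x.2
      refine ⟨F a, ?_⟩
      have : Subtype.val ⁻¹' (N a) ∈ 𝓝 x :=
        ((hNo a).preimage continuous_subtype_val).mem_nhds ha
      filter_upwards [this] with y hy
      exact mem_iInter.2 fun h => hN a ⟨y.1, h⟩ hy)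
  have hg0A : ∀ a : A, g0 ⟨a.1, hAU0 a⟩ ∈ Metric.ball (F a) (μ (F a)) := fun a =>
    mem_iInter.1 (hg0 ⟨a.1, hAU0 a⟩) a.2
  let U : Set M := Subtype.val '' (g0 ⁻¹' W)
  have hUU0 : U ⊆ U0 := by
    rintro _ ⟨x, -, rfl⟩
    exact x.2
  have hUW : ∀ x : U, g0 ⟨x.1, hUU0 x.2⟩ ∈ W := by
    rintro ⟨_, ⟨x, hx, rfl⟩⟩
    exact hx
  have hAU : A ⊆ U := fun a ha => ⟨⟨a, hAU0 ⟨a, ha⟩⟩, hμ _ (hg0A ⟨a, ha⟩), rfl⟩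
  refine ⟨U, hAU, hU0.isOpenMap_subtype_val _ (hW.preimage g0.continuous), ?_⟩
  let g : C(U, K) := ⟨fun x => G (g0 ⟨x.1, hUU0 x.2⟩, 1),
    hG.comp_continuous (by fun_prop) (fun x => Or.inl ⟨hUW x, by simp⟩)⟩
  let g1 : C(A, K) := ⟨fun x => G (F x, 1),
    hG.comp_continuous (by fun_prop) (fun x => Or.inl ⟨hFW x, by simp⟩)⟩
  refine ⟨g, ContinuousMap.Homotopic.trans (g := g1) ?_ ?_⟩
  · refine ⟨⟨⟨fun z => G (AffineMap.lineMap (g0 ⟨z.2.1, hAU0 z.2⟩) (F z.2) (z.1 : ℝ), 1),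
      hG.comp_continuous ?_ ?_⟩, ?_, ?_⟩⟩
    · simp only [AffineMap.lineMap_apply_module]
      fun_prop
    · intro z
      refine Or.inl ⟨?_, by simp⟩
      apply hμ (F z.2)
      refine (convex_ball (F z.2) (μ (F z.2))).lineMap_mem (hg0A z.2) ?_ z.1.2
      simpa using hμp _ (hFW z.2)
    · intro x
      simp [g]
      rfl
    · intro x
      simp [g1]
  · refine ⟨⟨⟨fun z => G (F z.2, 1 - (z.1 : ℝ)), hG.comp_continuous (by fun_prop) ?_⟩, ?_, ?_⟩⟩
    · intro z
      refine Or.inr ⟨⟨_, rfl⟩, ?_⟩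
      have := z.1.2
      constructor <;> simp [this.1, this.2]
    · intro x
      simp [g1]
    · intro x
      have := hG0 (F x) ⟨_, rfl⟩
      simp [this, F, hj]

/-- local homotopy section over `U` -/
def HasSec {E B : Type*} [TopologicalSpace E] [TopologicalSpace B] (p : C(E, B)) (U : Set B) :
    Prop := ∃ s : C(U, E), (p.comp s).Homotopic (restr U)

lemma hasSec_transfer {E B E' B' : Type*} [TopologicalSpace E] [TopologicalSpace B]
    [TopologicalSpace E'] [TopologicalSpace B'] (p : C(E, B)) (p' : C(E', B')) (α : C(E, E'))
    (β : C(B, B')) (γ : C(B', B)) (h1 : (p'.comp α).Homotopic (β.comp p))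
    (h2 : (β.comp γ).Homotopic (ContinuousMap.id B')) (U : Set B) (h : HasSec p U) :
    HasSec p' (γ ⁻¹' U) := by
  obtain ⟨s, hs⟩ := h
  let γU : C(γ ⁻¹' U, U) := ⟨fun x => ⟨γ x.1, x.2⟩, by fun_prop⟩
  refine ⟨(α.comp s).comp γU, ?_⟩
  have e1 : ((p'.comp α).comp (s.comp γU)).Homotopic ((β.comp p).comp (s.comp γU)) :=
    h1.comp (.refl _)
  have e2 : (β.comp ((p.comp s).comp γU)).Homotopic (β.comp ((restr U).comp γU)) :=
    .comp (.refl _) (hs.comp (.refl _))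
  have e3 : ((β.comp γ).comp (restr (γ ⁻¹' U))).Homotopic
    ((ContinuousMap.id B').comp (restr (γ ⁻¹' U))) := h2.comp (.refl _)
  exact (e1.trans e2).trans e3

lemma hasSec_open {E : Type u} {B : Type v} [TopologicalSpace E] [TopologicalSpace B]
    (hE : IsANR E) (hB : IsANR B) (p : C(E, B)) (A : Set B) (h : HasSec p A) :
    ∃ V, IsOpen V ∧ A ⊆ V ∧ HasSec p V := by
  obtain ⟨s, hs⟩ := h
  haveI := hB.1
  letI : MetricSpace B := TopologicalSpace.metrizableSpaceMetric B
  obtain ⟨U, hAU, hU, g, hg⟩ := ext_up_to_homotopy hE A s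
  let A' : Set U := Subtype.val ⁻¹' A
  let c : C(A', A) := ⟨fun x => ⟨x.1.1, x.2⟩, by fun_prop⟩
  have e1 : ((p.comp (g.comp (ContinuousMap.inclusion hAU))).comp c).Homotopic
      ((p.comp s).comp c) := .comp (.comp (.refl _) hg) (.refl _)
  have e2 : ((p.comp s).comp c).Homotopic ((restr A).comp c) := hs.comp (.refl _)
  obtain ⟨V, hV, hAV, hVh⟩ := homotopy_nhd hB (p.comp g) (restr U) A' (e1.trans e2)
  have hVU : Subtype.val '' V ⊆ U := by
    rintro _ ⟨x, -, rfl⟩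
    exact x.2
  have hmem : ∀ x : (Subtype.val '' V : Set B), (⟨x.1, hVU x.2⟩ : U) ∈ V := by
    rintro ⟨_, ⟨x, hx, rfl⟩⟩
    exact hx
  let d : C((Subtype.val '' V : Set B), V) := ⟨fun x => ⟨⟨x.1, hVU x.2⟩, hmem x⟩, by fun_prop⟩
  refine ⟨Subtype.val '' V, hU.isOpenMap_subtype_val _ hV,
    fun a ha => ⟨⟨a, hAU ha⟩, hAV ha, rfl⟩, (g.comp (restr V)).comp d, ?_⟩
  exact hVh.comp (.refl d)

theorem stmt14 {X : Type u} {Y : Type v} [TopologicalSpace X] [TopologicalSpace Y]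
    (hX : HasANRHomotopyType X) (hY : HasANRHomotopyType Y) (f : C(X, Y)) :
    secat f = gsecat f := by
  apply le_antisymm
  · obtain ⟨X', _, hX', ⟨e⟩⟩ := hX
    obtain ⟨Y', _, hY', ⟨d⟩⟩ := hY
    let h : C(X', Y') := (d.toFun.comp f).comp e.invFun
    apply sInf_le_sInf
    rintro n ⟨k, rfl, U, hcov, hs⟩
    refine ⟨k, rfl, ?_⟩
    have h1 : ∀ i, HasSec h (d.invFun ⁻¹' (U i)) := fun i =>
      hasSec_transfer f h e.toFun d.toFun d.invFun
        (ContinuousMap.Homotopic.comp (.refl (d.toFun.comp f)) e.left_inv) d.right_inv (U i) (hs i)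
    choose V hVo hV hVs using fun i => hasSec_open hX' hY' h _ (h1 i)
    have hVcov : ⋃ i, V i = univ := by
      refine eq_univ_of_forall fun y => ?_
      have : d.invFun y ∈ ⋃ i, U i := by rw [hcov]; trivial
      obtain ⟨i, hi⟩ := mem_iUnion.1 this
      exact mem_iUnion.2 ⟨i, hV i hi⟩
    refine ⟨fun i => d.toFun ⁻¹' (V i), fun i => (hVo i).preimage d.toFun.continuous, ?_, ?_⟩
    · rw [← preimage_iUnion, hVcov, preimage_univ]
    · intro i
      exact hasSec_transfer h f e.invFun d.invFun d.toFun
        (ContinuousMap.Homotopic.symm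
          (ContinuousMap.Homotopic.comp d.left_inv (.refl (f.comp e.invFun))))
        d.left_inv (V i) (hVs i)
  · apply sInf_le_sInf
    rintro n ⟨k, hk, U, -, h⟩
    exact ⟨k, hk, U, h⟩
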